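/- arXiv:math/0201135 — 4 statements merged into one kernel-verified Lean document; each statement's English description precedes it below -/
import Mathlib

section
/- Fix τ ∈ ℂ with Im τ > 0 and l ∈ ℤ, and let F : ℂ → ℂ be entire (complex differentiable on all of ℂ) with F(t+2) = F(t) and F(t+2τ) = e^{−πil(4τ+4t)} F(t) for all t ∈ ℂ. Let z₀ ∈ ℂ be such that F(z) ≠ 0 for every z on the four boundary segments {z₀+2s}, {z₀+2+2τs}, {z₀+2τ+2s}, {z₀+2τs} (s ∈ [0,1]) of the parallelogram with vertices z₀, z₀+2, z₀+2+2τ, z₀+2τ. Then the contour integral of F′/F around this parallelogram equals 8πil; explicitly, ∫₀¹ (F′/F)(z₀+2s)·2 ds + ∫₀¹ (F′/F)(z₀+2+2τs)·(2τ) ds − ∫₀¹ (F′/F)(z₀+2τ+2s)·2 ds − ∫₀¹ (F′/F)(z₀+2τs)·(2τ) ds = 8πil. -/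
/-- The logarithmic derivative of a periodic function is periodic. -/
theorem logDeriv_add_of_periodic {F : ℂ → ℂ} {c : ℂ} (h : ∀ t, F (t + c) = F t) (t : ℂ) :
    logDeriv F (t + c) = logDeriv F t := by
  have hd : deriv F (t + c) = deriv F t := by
    rw [← deriv_comp_add_const, funext h]
  rw [logDeriv_apply, logDeriv_apply, hd, h]

/-- If `F (t + c) = exp (a * (b + d * t)) * F t`, then translation by `c` adds `a * d` to the
logarithmic derivative of `F`. -/
theorem logDeriv_add_of_quasiperiodic {F : ℂ → ℂ} (hF : Differentiable ℂ F) {a b c d : ℂ}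
    (h : ∀ t, F (t + c) = Complex.exp (a * (b + d * t)) * F t) {t : ℂ} (ht : F t ≠ 0) :
    logDeriv F (t + c) = a * d + logDeriv F t := by
  have hexp : HasDerivAt (fun t => Complex.exp (a * (b + d * t)))
      (Complex.exp (a * (b + d * t)) * (a * d)) t := by
    simpa using ((((hasDerivAt_id t).const_mul d).const_add b).const_mul a).cexp
  have hd : deriv F (t + c) = Complex.exp (a * (b + d * t)) * (a * d) * F t +
      Complex.exp (a * (b + d * t)) * deriv F t := by
    rw [← deriv_comp_add_const, funext h]
    exact (hexp.mul (hF t).hasDerivAt).deriv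
  rw [logDeriv_apply, logDeriv_apply, hd, h]
  field_simp [Complex.exp_ne_zero]


/-- Contour-integral identity: for an entire `F` with the quasi-periodicities
`F(t+2) = F(t)`, `F(t+2τ) = e^{−πil(4τ+4t)} F(t)`, nonvanishing on the boundary
of the parallelogram with vertices `z₀, z₀+2, z₀+2+2τ, z₀+2τ`, the contour
integral of `F′/F` around this parallelogram equals `8πil`. -/
theorem contour_integral_logDeriv_eq (τ : ℂ) (hτ : 0 < τ.im) (l : ℤ) (F : ℂ → ℂ)
    (hF : Differentiable ℂ F)
    (h1 : ∀ t : ℂ, F (t + 2) = F t)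
    (h2 : ∀ t : ℂ, F (t + 2 * τ) =
      Complex.exp (-((Real.pi : ℂ) * Complex.I * (l : ℂ)) * (4 * τ + 4 * t)) * F t)
    (z₀ : ℂ)
    (hne : ∀ s : ℝ, s ∈ Set.Icc (0 : ℝ) 1 →
      F (z₀ + 2 * (s : ℂ)) ≠ 0 ∧ F (z₀ + 2 + 2 * τ * (s : ℂ)) ≠ 0 ∧
      F (z₀ + 2 * τ + 2 * (s : ℂ)) ≠ 0 ∧ F (z₀ + 2 * τ * (s : ℂ)) ≠ 0) :
    (∫ s in (0:ℝ)..1, (deriv F (z₀ + 2 * (s : ℂ)) / F (z₀ + 2 * (s : ℂ))) * 2)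
      + (∫ s in (0:ℝ)..1,
          (deriv F (z₀ + 2 + 2 * τ * (s : ℂ)) / F (z₀ + 2 + 2 * τ * (s : ℂ))) * (2 * τ))
      - (∫ s in (0:ℝ)..1,
          (deriv F (z₀ + 2 * τ + 2 * (s : ℂ)) / F (z₀ + 2 * τ + 2 * (s : ℂ))) * 2)
      - (∫ s in (0:ℝ)..1,
          (deriv F (z₀ + 2 * τ * (s : ℂ)) / F (z₀ + 2 * τ * (s : ℂ))) * (2 * τ))
      = 8 * (Real.pi : ℂ) * Complex.I * (l : ℂ) := by
  have hright : ∀ s : ℝ, deriv F (z₀ + 2 + 2 * τ * (s : ℂ)) / F (z₀ + 2 + 2 * τ * (s : ℂ)) =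
      deriv F (z₀ + 2 * τ * (s : ℂ)) / F (z₀ + 2 * τ * (s : ℂ)) := fun s => by
    rw [add_right_comm]
    exact logDeriv_add_of_periodic h1 _
  have htop : ∀ s ∈ Set.uIcc (0 : ℝ) 1,
      (deriv F (z₀ + 2 * τ + 2 * (s : ℂ)) / F (z₀ + 2 * τ + 2 * (s : ℂ))) * 2 =
      (deriv F (z₀ + 2 * (s : ℂ)) / F (z₀ + 2 * (s : ℂ))) * 2
        - 8 * (Real.pi : ℂ) * Complex.I * (l : ℂ) := fun s hs => by
    rw [Set.uIcc_of_le zero_le_one] at hs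
    have h := logDeriv_add_of_quasiperiodic hF h2 (hne s hs).1
    rw [logDeriv_apply, logDeriv_apply] at h
    rw [add_right_comm, h]
    ring
  have hint : IntervalIntegrable
      (fun s : ℝ => (deriv F (z₀ + 2 * (s : ℂ)) / F (z₀ + 2 * (s : ℂ))) * 2)
      MeasureTheory.volume 0 1 := by
    refine ContinuousOn.intervalIntegrable ?_
    rw [Set.uIcc_of_le zero_le_one]
    have hcF := hF.continuous
    have hcF' := (hF.contDiff (n := 1)).continuous_deriv le_rfl
    exact ((by fun_prop : Continuous fun s : ℝ => deriv F (z₀ + 2 * (s : ℂ))).continuousOn.div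
      (by fun_prop : Continuous fun s : ℝ => F (z₀ + 2 * (s : ℂ))).continuousOn
      fun s hs => (hne s hs).1).mul continuousOn_const
  simp only [hright]
  rw [intervalIntegral.integral_congr htop,
    intervalIntegral.integral_sub hint intervalIntegrable_const]
  simp
end

section
/- Fix τ ∈ ℂ with Im τ > 0 and an integer l < 0. If F : ℂ → ℂ is entire (complex differentiable on all of ℂ) and satisfies F(t+2) = F(t) and F(t+2τ) = e^{−πil(4τ+4t)} F(t) for all t ∈ ℂ, then F is identically zero. -/
/-- A continuous real function on `ℂ` with periods `2` and `2τ`, `τ` in the upper half plane,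
is bounded above. -/
theorem bddAbove_range_of_periodic_two_of_periodic_two_mul {τ : ℂ} (hτ : 0 < τ.im) {G : ℂ → ℝ}
    (hG : Continuous G) (h1 : Function.Periodic G 2) (h2 : Function.Periodic G (2 * τ)) :
    BddAbove (Set.range G) := by
  have hcont : Continuous fun p : ℝ × ℝ => G (p.1 * 2 + p.2 * (2 * τ)) := by fun_prop
  obtain ⟨C, hC⟩ := ((isCompact_Icc (a := (0 : ℝ)) (b := 1)).prod
    (isCompact_Icc (a := (0 : ℝ)) (b := 1))).bddAbove_image hcont.continuousOn
  refine ⟨C, ?_⟩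
  rintro _ ⟨t, rfl⟩
  set b : ℝ := t.im / (2 * τ.im) with hb
  set a : ℝ := (t.re - b * (2 * τ.re)) / 2 with ha
  have ht : t = (Int.fract a * 2 + Int.fract b * (2 * τ) : ℂ) + ⌊b⌋ * (2 * τ) + ⌊a⌋ * 2 := by
    have hdecomp : t = a * 2 + b * (2 * τ) := by
      apply Complex.ext
      · simp [ha]
      · simp
        rw [hb]
        field_simp
    have ha' : (a : ℂ) = ⌊a⌋ + (Int.fract a : ℝ) := by exact_mod_cast (Int.floor_add_fract a).symm
    have hb' : (b : ℂ) = ⌊b⌋ + (Int.fract b : ℝ) := by exact_mod_cast (Int.floor_add_fract b).symm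
    conv_lhs => rw [hdecomp, ha', hb']
    ring
  rw [ht, h1.int_mul, h2.int_mul]
  exact hC ⟨(Int.fract a, Int.fract b),
    ⟨⟨Int.fract_nonneg a, (Int.fract_lt_one a).le⟩, ⟨Int.fract_nonneg b, (Int.fract_lt_one b).le⟩⟩,
    rfl⟩

/-- For `τ ∈ ℍ` and a negative integer `l`, an entire function `F` with
`F(t+2) = F(t)` and `F(t+2τ) = e^{−πil(4τ+4t)} F(t)` is identically zero. -/
theorem entire_quasi_periodic_neg_anomaly_eq_zero (τ : ℂ) (hτ : 0 < τ.im)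
    (l : ℤ) (hl : l < 0) (F : ℂ → ℂ) (hF : Differentiable ℂ F)
    (h1 : ∀ t : ℂ, F (t + 2) = F t)
    (h2 : ∀ t : ℂ, F (t + 2 * τ) =
      Complex.exp (-((Real.pi : ℂ) * Complex.I * (l : ℂ)) * (4 * τ + 4 * t)) * F t) :
    ∀ t : ℂ, F t = 0 := by
  have hl' : (l : ℝ) < 0 := by exact_mod_cast hl
  have hnorm (t : ℂ) : ‖F (t + 2 * τ)‖ =
      Real.exp (4 * Real.pi * l * (τ.im + t.im)) * ‖F t‖ := by
    rw [h2, norm_mul, Complex.norm_exp]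
    congr 2
    simp
    ring
  set G : ℂ → ℝ := fun t => Real.exp (-(Real.pi * l / τ.im) * t.im ^ 2) * ‖F t‖ with hGdef
  have hG : Continuous G := by
    have := hF.continuous
    have := Complex.continuous_im
    fun_prop
  have hG1 : Function.Periodic G 2 := fun t => by simp [hGdef, h1]
  have hG2 : Function.Periodic G (2 * τ) := fun t => by
    simp only [hGdef, hnorm]
    rw [← mul_assoc, ← Real.exp_add]
    congr 2
    simp
    field_simp
    ring
  obtain ⟨C, hC⟩ := bddAbove_range_of_periodic_two_of_periodic_two_mul hτ hG hG1 hG2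
  have hbound (t : ℂ) : ‖F t‖ ≤ C := by
    refine le_trans (le_mul_of_one_le_left (norm_nonneg _) (Real.one_le_exp ?_)) (hC ⟨t, rfl⟩)
    have : Real.pi * l / τ.im ≤ 0 :=
      div_nonpos_of_nonpos_of_nonneg (mul_nonpos_of_nonneg_of_nonpos Real.pi_pos.le hl'.le) hτ.le
    exact mul_nonneg (neg_nonneg.2 this) (sq_nonneg _)
  have hconst (t s : ℂ) : F t = F s :=
    hF.apply_eq_apply_of_bounded
      (isBounded_iff_forall_norm_le.2 ⟨C, by rintro _ ⟨t, rfl⟩; exact hbound t⟩) t s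
  intro t
  have h0 := hnorm 0
  rw [hconst _ t, hconst 0 t, Complex.zero_im, add_zero] at h0
  have hlt : Real.exp (4 * Real.pi * l * τ.im) < 1 := by
    rw [Real.exp_lt_one_iff]
    exact mul_neg_of_neg_of_pos (mul_neg_of_pos_of_neg (by positivity) hl') hτ
  by_contra hne
  exact absurd h0 (mul_lt_of_lt_one_left (norm_pos_iff.2 hne) hlt).ne'
end

section
/- Let l ∈ ℤ with l ≤ 0, and let F : ℂ × ℍ → ℂ be a function, holomorphic in the first variable for each fixed τ ∈ ℍ, satisfying F(t+2, τ) = F(t, τ) and F(t+2τ, τ) = e^{−πil(4τ+4t)} F(t, τ) for all t ∈ ℂ and τ ∈ ℍ. Then F(t, τ) is independent of t, i.e. F(t, τ) = F(0, τ) for all t ∈ ℂ and τ ∈ ℍ; moreover if l < 0 then F is identically zero. -/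
open Complex

/-- A continuous function with period `2` whose norm does not increase under `t ↦ t + 2τ` on
`Im t ≥ -Im τ`, nor under `t ↦ t - 2τ` on `Im t ≤ Im τ`, is bounded. -/
theorem isBounded_range_of_norm_translate_le {τ : ℂ} (hτ : 0 < τ.im) {f : ℂ → ℂ}
    (hf : Continuous f) (hper : Function.Periodic f 2)
    (hup : ∀ t : ℂ, -τ.im ≤ t.im → ‖f (t + 2 * τ)‖ ≤ ‖f t‖)
    (hdown : ∀ t : ℂ, t.im ≤ τ.im → ‖f (t - 2 * τ)‖ ≤ ‖f t‖) :
    Bornology.IsBounded (Set.range f) := by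
  have hK : IsCompact (Set.Icc (0 : ℝ) 2 ×ℂ Set.Icc (-τ.im) τ.im) :=
    isCompact_Icc.reProdIm isCompact_Icc
  obtain ⟨M, hM⟩ := hK.exists_bound_of_continuousOn hf.continuousOn
  have hstrip : ∀ s : ℂ, -τ.im ≤ s.im → s.im ≤ τ.im → ‖f s‖ ≤ M := by
    intro s hs₁ hs₂
    have h := hM (s - (⌊s.re / 2⌋ : ℤ) * 2) (by
      have h₁ := Int.floor_le (s.re / 2)
      have h₂ := Int.lt_floor_add_one (s.re / 2)
      rw [mem_reProdIm]
      simp only [sub_re, sub_im, mul_re, mul_im, intCast_re, intCast_im, re_ofNat, im_ofNat,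
        Set.mem_Icc]
      refine ⟨⟨?_, ?_⟩, ?_, ?_⟩ <;> linarith)
    rwa [hper.sub_int_mul_eq] at h
  have hup' : ∀ n : ℕ, ∀ s : ℂ, -τ.im ≤ s.im → ‖f (s + n * (2 * τ))‖ ≤ ‖f s‖ := by
    intro n s hs
    induction n with
    | zero => simp
    | succ n ih =>
      have h := hup (s + n * (2 * τ)) (by
        have : (0 : ℝ) ≤ n * (2 * τ.im) := by positivity
        simp only [add_im, mul_im, natCast_re, natCast_im, re_ofNat, im_ofNat]
        linarith)
      rw [show s + ((n + 1 : ℕ) : ℂ) * (2 * τ) = s + n * (2 * τ) + 2 * τ by push_cast; ring]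
      exact h.trans ih
  have hdown' : ∀ n : ℕ, ∀ s : ℂ, s.im ≤ τ.im → ‖f (s - n * (2 * τ))‖ ≤ ‖f s‖ := by
    intro n s hs
    induction n with
    | zero => simp
    | succ n ih =>
      have h := hdown (s - n * (2 * τ)) (by
        have : (0 : ℝ) ≤ n * (2 * τ.im) := by positivity
        simp only [sub_im, mul_im, natCast_re, natCast_im, re_ofNat, im_ofNat]
        linarith)
      rw [show s - ((n + 1 : ℕ) : ℂ) * (2 * τ) = s - n * (2 * τ) - 2 * τ by push_cast; ring]
      exact h.trans ih
  refine isBounded_iff_forall_norm_le.2 ⟨M, ?_⟩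
  rintro _ ⟨t, rfl⟩
  obtain ⟨k, s, hs₁, hs₂, rfl⟩ :
      ∃ (k : ℤ) (s : ℂ), -τ.im ≤ s.im ∧ s.im ≤ τ.im ∧ t = s + k * (2 * τ) := by
    refine ⟨round (t.im / (2 * τ.im)), t - (round (t.im / (2 * τ.im)) : ℤ) * (2 * τ), ?_⟩
    have h := abs_le.1 (abs_sub_round (t.im / (2 * τ.im)))
    have hx : t.im / (2 * τ.im) * (2 * τ.im) = t.im := by field_simp
    simp only [sub_im, mul_im, intCast_re, intCast_im, re_ofNat, im_ofNat]
    refine ⟨?_, ?_, by ring⟩ <;> nlinarith [h.1, h.2]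
  obtain ⟨n, rfl | rfl⟩ := k.eq_nat_or_neg
  · exact_mod_cast (hup' n s hs₁).trans (hstrip s hs₁ hs₂)
  · have h := (hdown' n s hs₂).trans (hstrip s hs₁ hs₂)
    rwa [show s + ((-(n : ℤ) : ℤ) : ℂ) * (2 * τ) = s - n * (2 * τ) by push_cast; ring]

theorem norm_exp_rigidity_factor (l : ℤ) (τ t : ℂ) :
    ‖exp (-((Real.pi : ℂ) * I * (l : ℂ)) * (4 * τ + 4 * t))‖ =
      Real.exp (4 * Real.pi * l * (τ.im + t.im)) := by
  rw [norm_exp]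
  congr 1
  simp
  ring


/-- Rigidity and vanishing: let `l ≤ 0` and let `F : ℂ × ℍ → ℂ` be holomorphic
in the first variable for each fixed `τ ∈ ℍ`, with `F(t+2, τ) = F(t, τ)` and
`F(t+2τ, τ) = e^{−πil(4τ+4t)} F(t, τ)`. Then `F(t, τ)` is independent of `t`;
moreover if `l < 0` then `F` is identically zero. -/
theorem rigidity_and_vanishing (l : ℤ) (hl : l ≤ 0) (F : ℂ → ℂ → ℂ)
    (hF : ∀ τ : ℂ, 0 < τ.im → Differentiable ℂ (fun t => F t τ))
    (h1 : ∀ τ : ℂ, 0 < τ.im → ∀ t : ℂ, F (t + 2) τ = F t τ)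
    (h2 : ∀ τ : ℂ, 0 < τ.im → ∀ t : ℂ, F (t + 2 * τ) τ =
      Complex.exp (-((Real.pi : ℂ) * Complex.I * (l : ℂ)) * (4 * τ + 4 * t)) * F t τ) :
    (∀ τ : ℂ, 0 < τ.im → ∀ t : ℂ, F t τ = F 0 τ) ∧
      (l < 0 → ∀ τ : ℂ, 0 < τ.im → ∀ t : ℂ, F t τ = 0) := by
  have hconst : ∀ τ : ℂ, 0 < τ.im → ∀ t : ℂ, F t τ = F 0 τ := by
    intro τ hτ t
    have hl' : 4 * Real.pi * (l : ℝ) ≤ 0 :=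
      mul_nonpos_of_nonneg_of_nonpos (by positivity) (by exact_mod_cast hl)
    refine (hF τ hτ).apply_eq_apply_of_bounded
      (isBounded_range_of_norm_translate_le hτ (hF τ hτ).continuous (h1 τ hτ) ?_ ?_) t 0
    · intro t ht
      rw [h2 τ hτ, norm_mul, norm_exp_rigidity_factor]
      refine mul_le_of_le_one_left (norm_nonneg _) (Real.exp_le_one_iff.2 ?_)
      exact mul_nonpos_of_nonpos_of_nonneg hl' (by linarith)
    · intro t ht
      have h := congrArg norm (h2 τ hτ (t - 2 * τ))
      rw [sub_add_cancel, norm_mul, norm_exp_rigidity_factor] at h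
      rw [h]
      refine le_mul_of_one_le_left (norm_nonneg _) (Real.one_le_exp ?_)
      refine mul_nonneg_of_nonpos_of_nonpos hl' ?_
      simp only [sub_im, mul_im, re_ofNat, im_ofNat]
      linarith
  refine ⟨hconst, fun hneg τ hτ t => ?_⟩
  have h := congrArg norm (h2 τ hτ 0)
  rw [hconst τ hτ (0 + 2 * τ), norm_mul, norm_exp_rigidity_factor] at h
  have hlt : Real.exp (4 * Real.pi * l * (τ.im + (0 : ℂ).im)) < 1 := by
    refine Real.exp_lt_one_iff.2 (mul_neg_of_neg_of_pos ?_ (by simpa using hτ))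
    exact mul_neg_of_pos_of_neg (by positivity) (by exact_mod_cast hneg)
  rw [hconst τ hτ t, ← norm_eq_zero]
  nlinarith [norm_nonneg (F 0 τ)]
end

section
/- Fix τ ∈ ℂ with Im τ > 0 and l ∈ ℤ with l ≠ 0. There is no entire function F : ℂ → ℂ which is nowhere vanishing and satisfies F(t+2) = F(t) and F(t+2τ) = e^{−πil(4τ+4t)} F(t) for all t ∈ ℂ. -/
/-- If `F (t + ω) = exp (a + c * t) * F t`, then the logarithmic derivative of `F` is
additively quasi-periodic with period `ω` and increment `c`. -/
theorem logDeriv_add_of_forall_eq_exp_mul {F : ℂ → ℂ} (hF : Differentiable ℂ F)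
    (hF0 : ∀ t, F t ≠ 0) {ω a c : ℂ}
    (h : ∀ t, F (t + ω) = Complex.exp (a + c * t) * F t) (t : ℂ) :
    logDeriv F (t + ω) = logDeriv F t + c := by
  have h1 : HasDerivAt (fun s => F (s + ω)) (deriv F (t + ω)) t :=
    (hF (t + ω)).hasDerivAt.comp_add_const t ω
  have h2 : HasDerivAt (fun s => Complex.exp (a + c * s) * F s)
      (Complex.exp (a + c * t) * (c * 1) * F t + Complex.exp (a + c * t) * deriv F t) t :=
    ((((hasDerivAt_id t).const_mul c).const_add a).cexp).mul (hF t).hasDerivAt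
  have h3 := h1.unique ((funext h : (fun s => F (s + ω)) = _) ▸ h2)
  have he := Complex.exp_ne_zero (a + c * t)
  have ht := hF0 t
  rw [logDeriv_apply, logDeriv_apply, h3, h t]
  field_simp
  ring

/-- A primitive of a function with `g (t + ω) = g t + c` changes by an affine function
under translation by `ω`. -/
theorem HasDerivAt.add_eq_add_affine {H g : ℂ → ℂ} (hH : ∀ t, HasDerivAt H (g t) t) {ω c : ℂ}
    (hg : ∀ t, g (t + ω) = g t + c) (t : ℂ) :
    H (t + ω) = H t + c * t + (H ω - H 0) := by
  have hD : ∀ s, HasDerivAt (fun s => H (s + ω) - H s - c * s) 0 s := fun s => by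
    have := (((hH (s + ω)).comp_add_const s ω).sub (hH s)).sub ((hasDerivAt_id s).const_mul c)
    refine this.congr_deriv ?_
    rw [hg]
    ring
  have := is_const_of_deriv_eq_zero (fun s => (hD s).differentiableAt) (fun s => (hD s).deriv) t 0
  simp only [zero_add, mul_zero, sub_zero] at this
  linear_combination this

/-- For `τ ∈ ℍ` and a nonzero integer `l`, there is no entire, nowhere
vanishing function `F : ℂ → ℂ` with `F(t+2) = F(t)` and
`F(t+2τ) = e^{−πil(4τ+4t)} F(t)` for all `t ∈ ℂ`. -/
theorem no_nowhere_vanishing_quasi_periodic (τ : ℂ) (hτ : 0 < τ.im)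
    (l : ℤ) (hl : l ≠ 0) :
    ¬ ∃ F : ℂ → ℂ, Differentiable ℂ F ∧ (∀ t : ℂ, F t ≠ 0) ∧
      (∀ t : ℂ, F (t + 2) = F t) ∧
      (∀ t : ℂ, F (t + 2 * τ) =
        Complex.exp (-((Real.pi : ℂ) * Complex.I * (l : ℂ)) * (4 * τ + 4 * t)) * F t) := by
  rintro ⟨F, hF, hF0, hF2, hFτ⟩
  set c : ℂ := -(4 * (Real.pi * Complex.I * l)) with hc
  have hc0 : c ≠ 0 := by
    simp [hc, Real.pi_ne_zero, hl]
  have hg2 := logDeriv_add_of_forall_eq_exp_mul hF hF0 (ω := 2) (a := 0) (c := 0)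
    (fun t => by simp [hF2])
  have hgτ := logDeriv_add_of_forall_eq_exp_mul hF hF0 (ω := 2 * τ) (a := c * τ) (c := c)
    (fun t => by rw [hFτ, hc]; ring_nf)
  have hd : Differentiable ℂ (logDeriv F) :=
    (hF.contDiff (n := 2)).differentiable_deriv_two.div hF hF0
  obtain ⟨H, hH⟩ := hd.isExactOn_univ
  have hH' : ∀ t, HasDerivAt H (logDeriv F t) t := fun t => hH t (Set.mem_univ t)
  have e1 := HasDerivAt.add_eq_add_affine hH' hg2
  have e2 := HasDerivAt.add_eq_add_affine hH' hgτ
  have k1 := e1 (2 * τ)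
  have k2 := e2 2
  rw [add_comm 2 (2 * τ)] at k2
  have : c * 2 = 0 := by linear_combination k1 - k2
  exact hc0 (by simpa using this)
end
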